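/- arXiv:2112.02884 — 3 statements merged into one kernel-verified Lean document; each statement's English description precedes it below -/
import Mathlib

section
/- Asymmetry of the leading relation: for vertices p, i, j of a simple graph G with i ≠ j, if there exists a walk in G from p to j and every walk in G from p to j contains i in its support, then there exists a walk in G from p to i that does not contain j in its support; in particular, j does not lead i. -/
/-- `x` leads `y` (with requester `p`): `x ≠ y` and every walk from `p` to `y` contains `x`
in its support. -/
def Leads {V : Type*} (G : SimpleGraph V) (p x y : V) : Prop :=
  x ≠ y ∧ ∀ w : G.Walk p y, x ∈ w.support

/-- Asymmetry of the leading relation: if `i ≠ j`, there is a walk from `p` to `j`, and every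
walk from `p` to `j` contains `i` in its support, then some walk from `p` to `i` avoids `j`;
in particular `j` does not lead `i`. -/
theorem leads_asymm {V : Type*} (G : SimpleGraph V) (p i j : V) (hij : i ≠ j)
    (hreach : Nonempty (G.Walk p j))
    (h : ∀ w : G.Walk p j, i ∈ w.support) :
    (∃ w : G.Walk p i, j ∉ w.support) ∧ ¬ Leads G p j i := by
  classical
  obtain ⟨w, hw⟩ : ∃ w : G.Walk p i, j ∉ w.support := by
    obtain ⟨w⟩ := hreach
    exact ⟨w.bypass.takeUntil i (h w.bypass),
      SimpleGraph.Walk.endpoint_notMem_support_takeUntil w.bypass_isPath (h w.bypass) hij.symm⟩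
  exact ⟨⟨w, hw⟩, fun hlead => hw (hlead.2 w)⟩
end

section
/- Comparability of leaders (Proposition 1): let p, i, j, k be vertices of a simple graph G such that i is reachable from p, j ≠ k, j leads i, and k leads i. Then j leads k or k leads j. -/
/-- If a walk to `v` visits `a` or `b`, with `a ≠ b`, then its part after the last such visit
joins one of the two vertices to `v` and avoids the other. -/
theorem SimpleGraph.Walk.exists_walk_avoiding {V : Type*} {G : SimpleGraph V} {a b u v : V}
    (hab : a ≠ b) (w : G.Walk u v) (h : a ∈ w.support ∨ b ∈ w.support) :
    (∃ q : G.Walk a v, b ∉ q.support) ∨ ∃ q : G.Walk b v, a ∉ q.support := by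
  induction w with
  | nil =>
    simp only [SimpleGraph.Walk.support_nil, List.mem_singleton] at h
    rcases h with rfl | rfl
    · exact .inl ⟨.nil, by simpa using hab.symm⟩
    · exact .inr ⟨.nil, by simpa using hab⟩
  | cons e t ih =>
    by_cases ht : a ∈ t.support ∨ b ∈ t.support
    · exact ih ht
    · push Not at ht
      simp only [SimpleGraph.Walk.support_cons, List.mem_cons, ht.1, ht.2, or_false] at h
      rcases h with rfl | rfl
      · exact .inl ⟨.cons e t, by simp [hab.symm, ht.2]⟩
      · exact .inr ⟨.cons e t, by simp [hab, ht.1]⟩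

/-- A vertex leading `y` also leads every other vertex `x` from which `y` can be reached by a walk
avoiding it. -/
theorem Leads.of_walk_avoiding {V : Type*} {G : SimpleGraph V} {p a x y : V}
    (h : Leads G p a y) (hax : a ≠ x) (q : G.Walk x y) (hq : a ∉ q.support) :
    Leads G p a x :=
  ⟨hax, fun w => ((SimpleGraph.Walk.mem_support_append_iff w q).1 (h.2 (w.append q))).resolve_right
    hq⟩

/-- Comparability of leaders (Proposition 1): if `i` is reachable from `p`, `j ≠ k`, and both
`j` and `k` lead `i`, then `j` leads `k` or `k` leads `j`. -/
theorem leaders_comparable {V : Type*} (G : SimpleGraph V) (p i j k : V)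
    (hreach : Nonempty (G.Walk p i)) (hjk : j ≠ k)
    (hji : Leads G p j i) (hki : Leads G p k i) :
    Leads G p j k ∨ Leads G p k j := by
  obtain ⟨w⟩ := hreach
  rcases w.exists_walk_avoiding hjk (.inl (hji.2 w)) with ⟨q, hq⟩ | ⟨q, hq⟩
  · exact .inr (hki.of_walk_avoiding hjk.symm q hq)
  · exact .inl (hji.of_walk_avoiding hjk q hq)
end

section
/- The leaders of a vertex are linearly ordered (content of Proposition 2): let p and i be vertices of a simple graph G with i reachable from p, and let C_i be the set of vertices j with j ≠ i, j ≠ p, such that every walk in G from p to i contains j in its support. Then the leading relation restricted to C_i is a strict linear order: it is transitive on C_i, and for any two distinct j, k ∈ C_i exactly one of 'j leads k' and 'k leads j' holds. -/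
/-- The set of leaders of `i` (vertices `j ≠ i`, `j ≠ p`, lying on every walk from `p` to `i`). -/
def leaderSet {V : Type*} (G : SimpleGraph V) (p i : V) : Set V :=
  {j | j ≠ i ∧ j ≠ p ∧ ∀ w : G.Walk p i, j ∈ w.support}

theorem Leads.trans_walk {V : Type*} {G : SimpleGraph V} {p a b c : V}
    (hab : Leads G p a b) (hbc : Leads G p b c) (w : G.Walk p c) : a ∈ w.support := by
  classical
  exact w.support_takeUntil_subset_support (hbc.2 w) (hab.2 _)

/-- Two vertices, one of them reachable, cannot lead each other. -/
theorem Leads.not_symm_of_walk {V : Type*} {G : SimpleGraph V} {p a b : V}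
    (hab : Leads G p a b) (w : G.Walk p b) : ¬ Leads G p b a := by
  classical
  intro hba
  induction hn : w.length using Nat.strong_induction_on generalizing a b with
  | _ n ih =>
    exact ih _ (hn ▸ w.length_takeUntil_lt_length (hab.2 w) hab.1) hba
      (w.takeUntil a (hab.2 w)) hab rfl

/-- If `b` lies on every walk from `p` to `i` but does not lead `a`, then `b` leads `a` when
seen from `i`. -/
theorem leads_from_target {V : Type*} {G : SimpleGraph V} {p i a b : V}
    (hb : ∀ w : G.Walk p i, b ∈ w.support) (hne : b ≠ a) (h : ¬ Leads G p b a) :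
    Leads G i b a := by
  obtain ⟨u, hu⟩ : ∃ u : G.Walk p a, b ∉ u.support := by
    by_contra! hall
    exact h ⟨hne, hall⟩
  refine ⟨hne, fun q => ?_⟩
  have hmem := hb (u.append q.reverse)
  rw [SimpleGraph.Walk.mem_support_append_iff, SimpleGraph.Walk.support_reverse,
    List.mem_reverse] at hmem
  exact hmem.resolve_left hu

/-- The leaders of a vertex are linearly ordered (Proposition 2): if `i` is reachable from `p`,
the leading relation restricted to the leader set of `i` is transitive, and for any two
distinct leaders exactly one of the two leading relations holds. -/
theorem leaders_linearly_ordered {V : Type*} (G : SimpleGraph V) (p i : V)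
    (hreach : Nonempty (G.Walk p i)) :
    (∀ a ∈ leaderSet G p i, ∀ b ∈ leaderSet G p i, ∀ c ∈ leaderSet G p i,
      Leads G p a b → Leads G p b c → Leads G p a c) ∧
    (∀ a ∈ leaderSet G p i, ∀ b ∈ leaderSet G p i, a ≠ b →
      Xor' (Leads G p a b) (Leads G p b a)) := by
  classical
  obtain ⟨w⟩ := hreach
  refine ⟨fun a _ b hb c _ hab hbc => ⟨?_, hab.trans_walk hbc⟩, fun a ha b hb hne => ?_⟩
  · rintro rfl
    exact hab.not_symm_of_walk (w.takeUntil b (hb.2.2 w)) hbc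
  · by_cases hab : Leads G p a b
    · exact Or.inl ⟨hab, hab.not_symm_of_walk (w.takeUntil b (hb.2.2 w))⟩
    · refine Or.inr ⟨?_, hab⟩
      by_contra hba
      exact (leads_from_target ha.2.2 hne hab).not_symm_of_walk
        (w.dropUntil b (hb.2.2 w)).reverse (leads_from_target hb.2.2 hne.symm hba)
end
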